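/- Let (I,J) be an instance of Variable-Sized Bin Covering with unit supply such that NFD's solution has k ∈ {1,2,3} well-covered bins, each assigned at most two items, and at least one non-empty bin that is not well-covered; let i* be the head of the instance. Define I' = {1,…,i*} and I'' = I ∖ I', let J' be the set of items NFD assigns to bins in I' and J'' = J ∖ J'. Fix an optimal solution of (I,J), let A be the set of items it assigns to bins of I' and B = J ∖ A. Then OPT(I',A) + OPT(I'', B ∖ J'') ≤ 2·NFD(I',J'). -/

import Mathlib

open scoped Classical

noncomputable section

namespace BinCov

/-- Profit of a solution `S` on the bin set `B`: a bin `i ∈ B` earns profit `p i`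
if the total size of the items assigned to it is at least its demand `d i`. -/
def profit (d p s : ℕ → ℝ) (B : Finset ℕ) (S : ℕ → Finset ℕ) : ℝ :=
  ∑ i ∈ B, if d i ≤ ∑ j ∈ S i, s j then p i else 0

/-- A solution assigns pairwise disjoint subsets of the item set `T` to the bins. -/
def IsSolution (T : Finset ℕ) (S : ℕ → Finset ℕ) : Prop :=
  (∀ i, S i ⊆ T) ∧ Pairwise fun i i' => Disjoint (S i) (S i')

/-- Optimal profit over all solutions on bins `B` and items `T`. -/
def OPT (d p s : ℕ → ℝ) (B T : Finset ℕ) : ℝ :=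
  sSup (profit d p s B '' {S | IsSolution T S})

/-- Take a minimal prefix of `items` whose total size reaches `dem`;
returns this prefix together with the remaining items. -/
def takeFill (s : ℕ → ℝ) : ℝ → List ℕ → List ℕ × List ℕ
  | _, [] => ([], [])
  | dem, j :: rest =>
    if dem ≤ s j then ([j], rest)
    else
      let q := takeFill s (dem - s j) rest
      (j :: q.1, q.2)

/-- Next Fit Decreasing on the list `bins` of bins and the list `items` of still
unassigned items (both by index, i.e. in non-increasing order of demand resp. size):
if the unassigned items cannot cover the current bin, it is left empty; otherwise a
minimal prefix of the unassigned items is assigned to it.  Returns, for each bin,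
the set of items assigned to it. -/
def nfdAux (d s : ℕ → ℝ) : List ℕ → List ℕ → ℕ → Finset ℕ
  | [], _, _ => ∅
  | i :: bins, items, b =>
    if d i ≤ (items.map s).sum then
      let q := takeFill s (d i) items
      if b = i then q.1.toFinset else nfdAux d s bins q.2 b
    else
      if b = i then ∅ else nfdAux d s bins items b

/-- The solution produced by NFD on bin set `B` and item set `T` (bins and items are
processed in increasing order of index; demands and sizes are non-increasing in the index). -/
def nfdSol (d s : ℕ → ℝ) (B T : Finset ℕ) : ℕ → Finset ℕ :=
  nfdAux d s (B.sort (· ≤ ·)) (T.sort (· ≤ ·))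

/-- The total size `u i` that NFD assigns to bin `i`. -/
def nfdU (d s : ℕ → ℝ) (B T : Finset ℕ) (i : ℕ) : ℝ :=
  ∑ j ∈ nfdSol d s B T i, s j

/-- The profit NFD earns (Variable-Sized Bin Covering: the profit of a bin is its demand). -/
def NFD (d s : ℕ → ℝ) (B T : Finset ℕ) : ℝ :=
  profit d d s B (nfdSol d s B T)

/-- A bin `istar` with `u istar > 0` in NFD's solution (bins `0,…,m-1`, items `T`) is
well-covered if for the smallest index `i' > istar` with `u i' = 0` (which must exist)
one has `u i ≤ 2 * d i` for all bins `i ≤ i'`. -/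
def WellCovered (d s : ℕ → ℝ) (m : ℕ) (T : Finset ℕ) (istar : ℕ) : Prop :=
  istar < m ∧ 0 < nfdU d s (Finset.range m) T istar ∧
    ∃ i', istar < i' ∧ i' < m ∧ nfdU d s (Finset.range m) T i' = 0 ∧
      (∀ i, istar < i → i < i' → nfdU d s (Finset.range m) T i ≠ 0) ∧
      ∀ i ≤ i', nfdU d s (Finset.range m) T i ≤ 2 * d i

/-- `istar` is the head of the instance: letting `i0` be the smallest index of a non-empty
bin of NFD's solution that is not well-covered, and `i1 ≥ i0` the smallest index with
`u (i1+1) = 0`, the head is the largest index `istar ≤ i1` with `u istar > 2 * d istar`. -/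
def IsHead (d s : ℕ → ℝ) (m : ℕ) (T : Finset ℕ) (istar : ℕ) : Prop :=
  ∃ i0 i1,
    i0 < m ∧ 0 < nfdU d s (Finset.range m) T i0 ∧ ¬ WellCovered d s m T i0 ∧
    (∀ i < i0, 0 < nfdU d s (Finset.range m) T i → WellCovered d s m T i) ∧
    i0 ≤ i1 ∧ nfdU d s (Finset.range m) T (i1 + 1) = 0 ∧
    (∀ i, i0 ≤ i → i < i1 → nfdU d s (Finset.range m) T (i + 1) ≠ 0) ∧
    istar ≤ i1 ∧ 2 * d istar < nfdU d s (Finset.range m) T istar ∧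
    (∀ i ≤ i1, 2 * d i < nfdU d s (Finset.range m) T i → i ≤ istar)

/-- The inner loop of `ALG*` on one bin: `dcap` is the bin's demand (items are admissible iff
their size is at most `dcap`), `space` is the part of the demand not yet covered, and `rem j`
is the still unassigned part of item `j` (items `0,…,n-1`, sizes non-increasing in the index).
While the bin is not covered and some admissible item is not fully assigned, the largest such
item (i.e. the one of smallest index) is taken and its remaining part is assigned to the bin,
splitting it so that the bin is exactly covered if it would overflow.
Returns the updated remainders together with the total amount assigned to the bin. -/
def fillBin (s : ℕ → ℝ) (n : ℕ) (dcap : ℝ) : ℕ → ℝ → (ℕ → ℝ) → (ℕ → ℝ) × ℝ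
  | 0, _, rem => (rem, 0)
  | fuel + 1, space, rem =>
    if h : ∃ j, j < n ∧ s j ≤ dcap ∧ 0 < rem j then
      let j := Nat.find h
      if rem j ≤ space then
        let q := fillBin s n dcap fuel (space - rem j) (Function.update rem j 0)
        (q.1, q.2 + rem j)
      else
        (Function.update rem j (rem j - space), space)
    else (rem, 0)

/-- The outer loop of `ALG*`: the bins are processed in the given order (non-increasing
efficiency); returns the total amount assigned to each bin. -/
def algStarFillAux (d s : ℕ → ℝ) (n : ℕ) : List ℕ → (ℕ → ℝ) → ℕ → ℝ
  | [], _, _ => 0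
  | i :: bins, rem, b =>
    let q := fillBin s n (d i) n (d i) rem
    if b = i then q.2 else algStarFillAux d s n bins q.1 b

/-- The total amount `ALG*` assigns to each bin, on the instance with bins `0,…,m-1`
(in non-increasing order of efficiency) and items `0,…,n-1` (in non-increasing order of size). -/
def algStarFill (m n : ℕ) (d s : ℕ → ℝ) : ℕ → ℝ :=
  algStarFillAux d s n (List.range m) fun j => if j < n then s j else 0

/-- The modified profit `p*` of the solution produced by `ALG*`. -/
def algStarPStar (m n : ℕ) (d p s : ℕ → ℝ) : ℝ :=
  ∑ i ∈ Finset.range m, p i * min (algStarFill m n d s i / d i) 1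

/-- The optimum of the linear program for the modified Bin Covering problem. -/
def LPOpt (m n : ℕ) (d p s : ℕ → ℝ) : ℝ :=
  sSup {v : ℝ | ∃ y : ℕ → ℝ, ∃ x : ℕ → ℕ → ℝ,
    (∀ i < m, y i ≤ (∑ j ∈ Finset.range n, x j i) / d i) ∧
    (∀ j < n, ∑ i ∈ Finset.range m, x j i ≤ s j) ∧
    (∀ i, 0 ≤ y i ∧ y i ≤ 1) ∧
    (∀ j i, 0 ≤ x j i) ∧
    (∀ j < n, ∀ i < m, d i < s j → x j i = 0) ∧
    v = ∑ i ∈ Finset.range m, p i * y i}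

/-- A solution of the modified Bin Covering problem, assigning item parts from the
finite set `P` (part `q ∈ P` belongs to item `itm q`) to the bins `0,…,m-1`;
a part may only be assigned to a bin to which its item is admissible. -/
def IsPartSolution (m : ℕ) (d s : ℕ → ℝ) (itm : ℕ → ℕ) (P : Finset ℕ) (S : ℕ → Finset ℕ) : Prop :=
  (∀ i, S i ⊆ P) ∧ (Pairwise fun i i' => Disjoint (S i) (S i')) ∧
  (∀ i < m, ∀ q ∈ S i, s (itm q) ≤ d i) ∧ (∀ i, m ≤ i → S i = ∅)

/-- The modified profit `p*` of a solution, where `psz q` is the size of part `q`. -/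
def pStarParts (m : ℕ) (d p psz : ℕ → ℝ) (S : ℕ → Finset ℕ) : ℝ :=
  ∑ i ∈ Finset.range m, p i * min ((∑ q ∈ S i, psz q) / d i) 1

/-- A solution of the modified Bin Covering problem is maximal if there are no two distinct
bins `i`, `i'` with `0 < s(S_i) < d_i`, `0 < s(S_i') < d_i'` and `e_i ≤ e_i'` such that
some item of `S_i` is admissible to bin `i'`. -/
def MaximalMod (m : ℕ) (d p s : ℕ → ℝ) (S : ℕ → Finset ℕ) : Prop :=
  ¬ ∃ i i', i < m ∧ i' < m ∧ i ≠ i' ∧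
      (0 < ∑ j ∈ S i, s j) ∧ (∑ j ∈ S i, s j) < d i ∧
      (0 < ∑ j ∈ S i', s j) ∧ (∑ j ∈ S i', s j) < d i' ∧
      p i / d i ≤ p i' / d i' ∧ ∃ j ∈ S i, s j ≤ d i'

/-- A solution induced by a matching in the bipartite graph on bins and items with an
edge `ij` whenever `s j > d i`: every bin receives at most one item, and any item
assigned to a bin covers it singularly. -/
def IsMatchingSol (m n : ℕ) (d s : ℕ → ℝ) (S : ℕ → Finset ℕ) : Prop :=
  IsSolution (Finset.range n) S ∧ (∀ i, (S i).card ≤ 1) ∧ ∀ i < m, ∀ j ∈ S i, d i < s j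

end BinCov

namespace BinCov

/-- The items with index in `[p i, p (i + 1))` are those a Next Fit run on the bins `a, a+1, …`
before `c` and the items before `n` puts into bin `i`: none if the unassigned items cannot
cover it, and a minimal covering block otherwise. -/
def IsPointer (d s : ℕ → ℝ) (n a c : ℕ) (p : ℕ → ℕ) : Prop :=
  ∀ i, a ≤ i → i < c → p i ≤ p (i + 1) ∧ p (i + 1) ≤ n ∧
    ((p (i + 1) = p i ∧ ∑ j ∈ Finset.Ico (p i) n, s j < d i) ∨
      (p i < p (i + 1) ∧ d i ≤ ∑ j ∈ Finset.Ico (p i) (p (i + 1)), s j ∧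
        ∑ j ∈ Finset.Ico (p i) (p (i + 1) - 1), s j < d i))

lemma sum_map_range' (s : ℕ → ℝ) (l b : ℕ) :
    ((List.range' b l).map s).sum = ∑ j ∈ Finset.Ico b (b + l), s j := by
  induction l generalizing b with
  | zero => simp
  | succ l ih =>
    rw [List.range'_succ, List.map_cons, List.sum_cons, ih,
      Finset.sum_eq_sum_Ico_succ_bot (show b < b + (l + 1) by omega)]
    congr 3
    omega

lemma toFinset_range' (b l : ℕ) : (List.range' b l).toFinset = Finset.Ico b (b + l) := by
  ext x
  simp [List.mem_range'_1]

lemma takeFill_range' (s : ℕ → ℝ) (l b : ℕ) (x : ℝ) (hx : 0 < x)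
    (h : x ≤ ∑ j ∈ Finset.Ico b (b + l), s j) :
    ∃ r, b < r ∧ r ≤ b + l ∧
      takeFill s x (List.range' b l) = (List.range' b (r - b), List.range' r (b + l - r)) ∧
      x ≤ ∑ j ∈ Finset.Ico b r, s j ∧ ∑ j ∈ Finset.Ico b (r - 1), s j < x := by
  induction l generalizing b x with
  | zero => simp at h; linarith
  | succ l ih =>
    rw [List.range'_succ, takeFill]
    by_cases hb : x ≤ s b
    · refine ⟨b + 1, by omega, by omega, ?_, by simpa using hb, by simpa using hx⟩
      rw [if_pos hb]
      simp [show b + (l + 1) - (b + 1) = l by omega]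
    · rw [if_neg hb]
      rw [Finset.sum_eq_sum_Ico_succ_bot (show b < b + (l + 1) by omega),
        show b + (l + 1) = b + 1 + l by omega] at h
      obtain ⟨r, h1, h2, h3, h4, h5⟩ := ih (b + 1) (x - s b) (by linarith) (by linarith)
      refine ⟨r, by omega, by omega, ?_, ?_, ?_⟩
      · rw [h3, show r - b = (r - (b + 1)) + 1 by omega, List.range'_succ,
          show b + (l + 1) = b + 1 + l by omega]
      · rw [Finset.sum_eq_sum_Ico_succ_bot (show b < r by omega)]
        linarith
      · rw [Finset.sum_eq_sum_Ico_succ_bot (show b < r - 1 by omega)]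
        linarith

lemma nfdAux_eq_empty (d s : ℕ → ℝ) (bins items : List ℕ) (i : ℕ) (hi : i ∉ bins) :
    nfdAux d s bins items i = ∅ := by
  induction bins generalizing items with
  | nil => rfl
  | cons a bins ih =>
    simp only [List.mem_cons, not_or] at hi
    simp [nfdAux, hi.1, ih _ hi.2]

lemma exists_pointer_nfdAux (d s : ℕ → ℝ) (n k a b : ℕ) (hb : b ≤ n)
    (hd : ∀ i, a ≤ i → i < a + k → 0 < d i) :
    ∃ p : ℕ → ℕ, p a = b ∧ IsPointer d s n a (a + k) p ∧
      ∀ i, a ≤ i → i < a + k →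
        nfdAux d s (List.range' a k) (List.range' b (n - b)) i = Finset.Ico (p i) (p (i + 1)) := by
  induction k generalizing a b with
  | zero =>
    exact ⟨fun _ => b, rfl, fun i h1 h2 => by omega, fun i h1 h2 => by omega⟩
  | succ k ih =>
    rw [List.range'_succ]
    by_cases hc : d a ≤ ((List.range' b (n - b)).map s).sum
    · have hc' := hc
      rw [sum_map_range'] at hc'
      obtain ⟨r, h1, h2, h3, h4, h5⟩ :=
        takeFill_range' s (n - b) b (d a) (hd a le_rfl (by omega)) hc'
      rw [show b + (n - b) = n by omega] at h2 h3
      obtain ⟨q, q1, q2, q3⟩ := ih (a + 1) r h2 (fun i hi hi' => hd i (by omega) (by omega))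
      refine ⟨fun i => if i = a then b else q i, by simp, ?_, ?_⟩
      · intro i hi hi'
        rcases hi.eq_or_lt with rfl | hlt
        · simp only [if_true, Nat.succ_ne_self, if_false, q1]
          exact ⟨h1.le, h2, Or.inr ⟨h1, h4, h5⟩⟩
        · simpa [show i ≠ a by omega, show i + 1 ≠ a by omega] using q2 i hlt (by omega)
      · intro i hi hi'
        simp only [nfdAux, if_pos hc, h3]
        rcases hi.eq_or_lt with rfl | hlt
        · simp [toFinset_range', q1, show b + (r - b) = r by omega]
        · simpa [show i ≠ a by omega, show i + 1 ≠ a by omega] using q3 i hlt (by omega)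
    · have hc' := hc
      rw [sum_map_range', show b + (n - b) = n by omega, not_le] at hc'
      obtain ⟨q, q1, q2, q3⟩ := ih (a + 1) b hb (fun i hi hi' => hd i (by omega) (by omega))
      refine ⟨fun i => if i = a then b else q i, by simp, ?_, ?_⟩
      · intro i hi hi'
        rcases hi.eq_or_lt with rfl | hlt
        · simp only [if_true, Nat.succ_ne_self, if_false, q1]
          exact ⟨le_rfl, hb, Or.inl ⟨trivial, hc'⟩⟩
        · simpa [show i ≠ a by omega, show i + 1 ≠ a by omega] using q2 i hlt (by omega)
      · intro i hi hi'
        simp only [nfdAux, if_neg hc]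
        rcases hi.eq_or_lt with rfl | hlt
        · simp [q1]
        · simpa [show i ≠ a by omega, show i + 1 ≠ a by omega] using q3 i hlt (by omega)

lemma sort_range (n : ℕ) : (Finset.range n).sort (· ≤ ·) = List.range' 0 n := by
  rw [← List.range_eq_range']
  refine List.Perm.eq_of_pairwise' (r := (· ≤ ·)) ?_ ?_ ?_
  · exact Finset.pairwise_sort _ _
  · exact List.pairwise_le_range
  · rw [List.perm_ext_iff_of_nodup (Finset.sort_nodup _ _) List.nodup_range]
    simp

/-- Next Fit Decreasing assigns consecutive blocks of items. -/
lemma exists_pointer_nfdSol (d s : ℕ → ℝ) (m n : ℕ) (hd : ∀ i < m, 0 < d i) :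
    ∃ p : ℕ → ℕ, p 0 = 0 ∧ IsPointer d s n 0 m p ∧
      ∀ i < m, nfdSol d s (Finset.range m) (Finset.range n) i = Finset.Ico (p i) (p (i + 1)) := by
  obtain ⟨p, h1, h2, h3⟩ :=
    exists_pointer_nfdAux d s n m 0 0 (Nat.zero_le _) (fun i _ hi => hd i (by omega))
  rw [Nat.zero_add] at h2 h3
  refine ⟨p, h1, h2, fun i hi => ?_⟩
  rw [nfdSol, sort_range, sort_range]
  exact h3 i (Nat.zero_le _) hi

lemma nfdU_eq_zero_of_le (d s : ℕ → ℝ) (m : ℕ) (T : Finset ℕ) (i : ℕ) (hi : m ≤ i) :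
    nfdU d s (Finset.range m) T i = 0 := by
  rw [nfdU, nfdSol, nfdAux_eq_empty, Finset.sum_empty]
  simpa using hi

lemma IsPointer.mono_of_le {d s : ℕ → ℝ} {n c : ℕ} {p : ℕ → ℕ} (hp : IsPointer d s n 0 c p)
    {i i' : ℕ} (h : i ≤ i') (hc : i' ≤ c) : p i ≤ p i' := by
  induction i', h using Nat.le_induction with
  | base => exact le_rfl
  | succ k hk ih => exact (ih (by omega)).trans (hp k (Nat.zero_le _) (by omega)).1

lemma sum_Ico_le_sum_Ico {s : ℕ → ℝ} {n : ℕ} (hs : ∀ j < n, 0 < s j) {a b c : ℕ} (h : b ≤ c)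
    (hc : c ≤ n) : ∑ j ∈ Finset.Ico a b, s j ≤ ∑ j ∈ Finset.Ico a c, s j := by
  refine Finset.sum_le_sum_of_subset_of_nonneg (Finset.Ico_subset_Ico le_rfl h) ?_
  intro j hj _
  exact (hs j (by rw [Finset.mem_Ico] at hj; omega)).le

/-- Removing the items that a Next Fit run does not use before bin `M` does not change the run. -/
lemma IsPointer.eq_of_restrict {d s : ℕ → ℝ} {m n M : ℕ} {p q : ℕ → ℕ} (hs : ∀ j < n, 0 < s j)
    (hM : M ≤ m) (hp : IsPointer d s n 0 m p) (hpn : p M ≤ n) (hq : IsPointer d s (p M) 0 M q)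
    (h0 : q 0 = p 0) (i : ℕ) (hi : i ≤ M) : q i = p i := by
  induction i with
  | zero => exact h0
  | succ i ih =>
    have ih := ih (by omega)
    obtain ⟨-, b1, b2⟩ := hp i (Nat.zero_le _) (by omega)
    obtain ⟨-, a1, a2⟩ := hq i (Nat.zero_le _) (by omega)
    have hle : p (i + 1) ≤ p M := hp.mono_of_le hi hM
    rw [ih] at a2
    rcases b2 with ⟨e1, e2⟩ | ⟨e1, e2, e3⟩ <;> rcases a2 with ⟨f1, f2⟩ | ⟨f1, f2, f3⟩
    · omega
    · have := sum_Ico_le_sum_Ico (a := p i) hs (a1.trans hpn) le_rfl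
      linarith
    · have := sum_Ico_le_sum_Ico (a := p i) hs hle hpn
      linarith
    · rcases lt_trichotomy (q (i + 1)) (p (i + 1)) with h | h | h
      · have := sum_Ico_le_sum_Ico (a := p i) hs (show q (i + 1) ≤ p (i + 1) - 1 by omega)
          (by omega)
        linarith
      · exact h
      · have := sum_Ico_le_sum_Ico (a := p i) hs (show p (i + 1) ≤ q (i + 1) - 1 by omega)
          (by omega)
        linarith

/-- Abel summation: a non-increasing weighting of a sequence with non-negative partial sums. -/
lemma mul_sum_le_sum_mul_of_antitone (c d : ℕ → ℝ) (N : ℕ) (D : ℝ)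
    (hdm : ∀ i i', i ≤ i' → i' < N → d i' ≤ d i) (hD : ∀ i < N, D ≤ d i)
    (hc : ∀ i ≤ N, 0 ≤ ∑ k ∈ Finset.range i, c k) :
    D * ∑ i ∈ Finset.range N, c i ≤ ∑ i ∈ Finset.range N, c i * d i := by
  induction N generalizing D with
  | zero => simp
  | succ N ih =>
    have h1 := ih (d N) (fun i i' h h' => hdm i i' h (by omega))
      (fun i hi => hdm i N hi.le (by omega)) (fun i hi => hc i (by omega))
    have h2 := mul_le_mul_of_nonneg_right (hD N (by omega)) (hc (N + 1) le_rfl)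
    rw [Finset.sum_range_succ] at h2 ⊢
    rw [Finset.sum_range_succ]
    nlinarith

/-- At most `#T` members of a disjoint family meet `T`. -/
lemma card_le_card_of_disjoint_of_meet (S : ℕ → Finset ℕ)
    (hS : Pairwise fun i i' => Disjoint (S i) (S i')) (F T : Finset ℕ)
    (h : ∀ i ∈ F, ∃ j ∈ S i, j ∈ T) : F.card ≤ T.card := by
  choose! f hf hfT using h
  refine Finset.card_le_card_of_injOn f hfT ?_
  intro a ha b hb hab
  by_contra hne
  exact Finset.disjoint_left.1 (hS hne) (hf a ha) (hab ▸ hf b hb)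

/-- A Next Fit block whose items are all larger than `2 * D` has at most `d i / D` items. -/
lemma card_mul_le_of_minimal_block {s : ℕ → ℝ} {a b : ℕ} {x D : ℝ} (hab : a < b) (hD : 0 < D)
    (hDx : D ≤ x) (hmin : ∑ j ∈ Finset.Ico a (b - 1), s j < x)
    (hbig : ∀ j, a ≤ j → j < b → 2 * D < s j) : ((b : ℝ) - a) * D ≤ x := by
  have h1 : ((b - 1 - a : ℕ) : ℝ) * (2 * D) ≤ ∑ j ∈ Finset.Ico a (b - 1), s j := by
    have := Finset.card_nsmul_le_sum (Finset.Ico a (b - 1)) s (2 * D) (fun j hj => by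
      rw [Finset.mem_Ico] at hj
      exact (hbig j hj.1 (by omega)).le)
    simpa using this
  obtain ⟨t, rfl⟩ : ∃ t, b = a + 1 + t := ⟨b - (a + 1), by omega⟩
  rw [show a + 1 + t - 1 - a = t by omega] at h1
  push_cast
  rcases Nat.eq_zero_or_pos t with rfl | ht
  · simpa using hDx
  · have : (1 : ℝ) ≤ t := by exact_mod_cast ht
    nlinarith

/-- A Next Fit block of total size more than twice the demand starts with an item larger
than twice the demand, and has no further items. -/
lemma block_singleton_of_two_mul_lt {s : ℕ → ℝ} {n a b : ℕ} {x : ℝ} (hs : ∀ j < n, 0 < s j)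
    (hsm : ∀ j j', j ≤ j' → j' < n → s j' ≤ s j) (hab : a < b) (hb : b ≤ n)
    (hmin : ∑ j ∈ Finset.Ico a (b - 1), s j < x) (hbig : 2 * x < ∑ j ∈ Finset.Ico a b, s j) :
    b = a + 1 := by
  by_contra hne
  obtain ⟨t, rfl⟩ : ∃ t, b = t + 1 := ⟨b - 1, by omega⟩
  rw [Nat.add_sub_cancel] at hmin
  rw [Finset.sum_Ico_succ_top (by omega)] at hbig
  have h1 : s a ≤ ∑ j ∈ Finset.Ico a t, s j := by
    refine Finset.single_le_sum (f := s) (fun j hj => ?_) (by simp; omega)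
    rw [Finset.mem_Ico] at hj
    exact (hs j (by omega)).le
  have h2 := hsm a t (by omega) (by omega)
  linarith

lemma OPT_le (d s : ℕ → ℝ) (B T : Finset ℕ) (x : ℝ)
    (h : ∀ S, IsSolution T S → profit d d s B S ≤ x) : OPT d d s B T ≤ x := by
  refine csSup_le ⟨_, fun _ => ∅, ⟨by simp, fun _ _ _ => by simp⟩, rfl⟩ ?_
  rintro _ ⟨S, hS, rfl⟩
  exact h S hS

lemma profit_le_card_mul (d s : ℕ → ℝ) (B T : Finset ℕ) (S : ℕ → Finset ℕ) (D : ℝ) (hD : 0 ≤ D)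
    (hd : ∀ i ∈ B, 0 < d i) (hdD : ∀ i ∈ B, d i ≤ D) (hS : IsSolution T S) :
    profit d d s B S ≤ T.card * D := by
  have h1 : profit d d s B S ≤ (B.filter fun i => d i ≤ ∑ j ∈ S i, s j).card * D := by
    rw [profit, ← Finset.sum_filter, ← nsmul_eq_mul]
    exact Finset.sum_le_card_nsmul _ _ _ fun i hi => hdD i (Finset.mem_filter.1 hi).1
  refine h1.trans (mul_le_mul_of_nonneg_right (Nat.cast_le.2 ?_) hD)
  refine card_le_card_of_disjoint_of_meet S hS.2 _ _ fun i hi => ?_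
  rw [Finset.mem_filter] at hi
  have hne : (S i).Nonempty := by
    by_contra hne
    rw [Finset.not_nonempty_iff_eq_empty] at hne
    have := hi.2
    rw [hne, Finset.sum_empty] at this
    exact absurd (hd i hi.1) (not_lt.2 this)
  exact ⟨hne.choose, hne.choose_spec, hS.1 i hne.choose_spec⟩

/-- If Next Fit leaves bin `e` empty, then every bin up to `e` that a solution covers contains
an item that Next Fit assigned before bin `e`. -/
lemma card_covered_le_of_skipped {d s : ℕ → ℝ} {n e b : ℕ} {A : Finset ℕ} {S : ℕ → Finset ℕ}
    (hs : ∀ j < n, 0 < s j) (hdm : ∀ i ≤ e, d e ≤ d i) (hA : A ⊆ Finset.range n)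
    (hS : IsSolution A S) (hb : ∑ j ∈ Finset.Ico b n, s j < d e) :
    ((Finset.range (e + 1)).filter fun i => d i ≤ ∑ j ∈ S i, s j).card ≤
      (A ∩ Finset.range b).card := by
  refine card_le_card_of_disjoint_of_meet S hS.2 _ _ fun i hi => ?_
  rw [Finset.mem_filter, Finset.mem_range] at hi
  by_contra! hne
  have hsub : S i ⊆ Finset.Ico b n := fun j hj => by
    have h1 := hS.1 i hj
    have h2 := Finset.mem_range.1 (hA h1)
    have h3 := hne j hj
    simp only [Finset.mem_inter, Finset.mem_range, not_and, not_lt] at h3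
    exact Finset.mem_Ico.2 ⟨h3 h1, h2⟩
  have := Finset.sum_le_sum_of_subset_of_nonneg (f := s) hsub
    (fun j hj _ => (hs j (Finset.mem_Ico.1 hj).2).le)
  have := hdm i (by omega)
  linarith [hi.2]

/- STATEMENT 16 -/
theorem stmt16 (m n : ℕ) (d s : ℕ → ℝ)
    (hd : ∀ i < m, 0 < d i) (hdm : ∀ i i', i ≤ i' → i' < m → d i' ≤ d i)
    (hs : ∀ j < n, 0 < s j) (hsm : ∀ j j', j ≤ j' → j' < n → s j' ≤ s j)
    (hk1 : 1 ≤ ((Finset.range m).filter (WellCovered d s m (Finset.range n))).card)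
    (hk3 : ((Finset.range m).filter (WellCovered d s m (Finset.range n))).card ≤ 3)
    (htwo : ∀ i, WellCovered d s m (Finset.range n) i →
      (nfdSol d s (Finset.range m) (Finset.range n) i).card ≤ 2)
    (istar : ℕ) (hhead : IsHead d s m (Finset.range n) istar)
    (O : ℕ → Finset ℕ) (hO : IsSolution (Finset.range n) O)
    (hOopt : profit d d s (Finset.range m) O = OPT d d s (Finset.range m) (Finset.range n)) :
    OPT d d s (Finset.range (istar + 1)) ((Finset.range (istar + 1)).biUnion O) +
      OPT d d s (Finset.range m \ Finset.range (istar + 1))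
        ((Finset.range n \ (Finset.range (istar + 1)).biUnion O) \
          (Finset.range n \ (Finset.range (istar + 1)).biUnion
            (nfdSol d s (Finset.range m) (Finset.range n)))) ≤
      2 * NFD d s (Finset.range (istar + 1))
        ((Finset.range (istar + 1)).biUnion (nfdSol d s (Finset.range m) (Finset.range n))) := by
  obtain ⟨i0, i1, hi0m, hi0, hi0w, hbefore, hi01, hi1e, hmid, hsi1, hsu, -⟩ := hhead
  obtain ⟨p, hp0, hp, hN⟩ := exists_pointer_nfdSol d s m n hd
  have hU : ∀ i < m, nfdU d s (Finset.range m) (Finset.range n) i =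
      ∑ j ∈ Finset.Ico (p i) (p (i + 1)), s j := fun i hi => by rw [nfdU, hN i hi]
  have hi1m : i1 < m := by
    by_contra hge
    exact hmid (m - 1) (by omega) (by omega) (nfdU_eq_zero_of_le d s m _ _ (by omega))
  have hsm' : istar < m := by omega
  have hds : 0 < d istar := hd istar hsm'
  have hi0s : i0 ≤ istar := by
    by_contra! hlt
    obtain ⟨-, -, i', h1, -, -, -, h2⟩ := hbefore istar hlt (by linarith)
    linarith [h2 istar h1.le]
  have hmidne : ∀ i, i0 ≤ i → i ≤ istar → p i < p (i + 1) := by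
    intro i h1 h2
    have hne : nfdU d s (Finset.range m) (Finset.range n) i ≠ 0 := by
      rcases h1.eq_or_lt with rfl | h1
      · exact hi0.ne'
      · obtain ⟨k, rfl⟩ : ∃ k, i = k + 1 := ⟨i - 1, by omega⟩
        exact hmid k (by omega) (by omega)
    by_contra hlt
    rw [hU i (by omega), Finset.Ico_eq_empty hlt] at hne
    simp at hne
  have hcov : ∀ i < m, p i < p (i + 1) → d i ≤ ∑ j ∈ Finset.Ico (p i) (p (i + 1)), s j ∧
      ∑ j ∈ Finset.Ico (p i) (p (i + 1) - 1), s j < d i := by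
    intro i hi hlt
    rcases (hp i (Nat.zero_le _) hi).2.2 with h | h
    · omega
    · exact h.2
  have hwell : ∀ i < i0, p i < p (i + 1) → WellCovered d s m (Finset.range n) i := by
    intro i hi hlt
    refine hbefore i hi ?_
    rw [hU i (by omega)]
    linarith [(hcov i (by omega) hlt).1, hd i (by omega)]
  have htwo' : ∀ i < i0, p (i + 1) ≤ p i + 2 := by
    intro i hi
    by_cases hlt : p i < p (i + 1)
    · have := htwo i (hwell i hi hlt)
      rw [hN i (by omega), Nat.card_Ico] at this
      omega
    · omega
  have hskip : ∀ i < m, ¬ p i < p (i + 1) → p (i + 1) = p i ∧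
      ∑ j ∈ Finset.Ico (p i) n, s j < d i := by
    intro i hi hlt
    rcases (hp i (Nat.zero_le _) hi).2.2 with h | h
    · exact h
    · exact absurd h.1 hlt
  have hlast : ∀ e, e + 1 = i0 → ¬ p e < p (e + 1) := by
    intro e he hlt
    obtain ⟨-, -, i', h1, h2, h3, h4, h5⟩ := hwell e (by omega) hlt
    have hne : i' ≠ i0 := by
      rintro rfl
      exact hi0.ne' h3
    exact hi0w ⟨hi0m, hi0, i', by omega, h2, h3, fun i h h' => h4 i (by omega) h', h5⟩
  have hpn : ∀ i ≤ m, p i ≤ n := by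
    intro i hi
    rcases Nat.eq_zero_or_pos i with rfl | h
    · omega
    · obtain ⟨k, rfl⟩ : ∃ k, i = k + 1 := ⟨i - 1, by omega⟩
      exact (hp k (Nat.zero_le _) (by omega)).2.1
  have hbigitem : ∀ j < p (istar + 1), 2 * d istar < s j := by
    intro j hj
    have hlt := hmidne istar hi0s le_rfl
    have hle := hpn (istar + 1) (by omega)
    rw [hU istar hsm'] at hsu
    have heq := block_singleton_of_two_mul_lt hs hsm hlt hle (hcov istar hsm' hlt).2 hsu
    rw [heq, Nat.Ico_succ_singleton, Finset.sum_singleton] at hsu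
    exact hsu.trans_le (hsm _ _ (by omega) (by omega))
  have hJ : ∀ M ≤ m, (Finset.range M).biUnion
      (nfdSol d s (Finset.range m) (Finset.range n)) = Finset.range (p M) := by
    intro M hM
    induction M with
    | zero => simp [hp0]
    | succ M ih =>
      have : p M ≤ p (M + 1) := hp.mono_of_le (Nat.le_succ M) hM
      rw [Finset.range_add_one, Finset.biUnion_insert, ih (by omega), hN M (by omega)]
      ext j
      simp only [Finset.mem_union, Finset.mem_Ico, Finset.mem_range]
      omega
  rw [hJ (istar + 1) (by omega)]
  set A := (Finset.range (istar + 1)).biUnion O with hA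
  have hAn : A ⊆ Finset.range n := Finset.biUnion_subset.2 fun i _ => hO.1 i
  obtain ⟨q, hq0, hq, hNq⟩ := exists_pointer_nfdSol d s (istar + 1) (p (istar + 1))
    (fun i hi => hd i (by omega))
  have hNFD : NFD d s (Finset.range (istar + 1)) (Finset.range (p (istar + 1))) =
      ∑ i ∈ Finset.range (istar + 1), (if p i < p (i + 1) then 1 else 0) * d i := by
    rw [NFD, profit]
    refine Finset.sum_congr rfl fun i hi => ?_
    have hi := Finset.mem_range.1 hi
    have heq := IsPointer.eq_of_restrict hs (show istar + 1 ≤ m by omega) hp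
      (hpn _ (by omega)) hq (by omega)
    rw [hNq i hi, heq i hi.le, heq (i + 1) hi]
    by_cases hlt : p i < p (i + 1)
    · rw [if_pos (hcov i (by omega) hlt).1, if_pos hlt, one_mul]
    · rw [if_neg hlt, Finset.Ico_eq_empty hlt, Finset.sum_empty, zero_mul,
        if_neg (not_le.2 (hd i (by omega)))]
  rw [hNFD]
  set T := (Finset.range n \ A) \ (Finset.range n \ Finset.range (p (istar + 1))) with hT
  have hTsub : T ⊆ (Finset.range (p i0) \ A) ∪ Finset.Ico (p i0) (p (istar + 1)) := by
    intro j
    simp only [hT, Finset.mem_sdiff, Finset.mem_union, Finset.mem_Ico, Finset.mem_range]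
    intro h
    by_cases hj : j < p i0
    · exact Or.inl ⟨hj, h.1.2⟩
    · exact Or.inr ⟨by omega, by by_contra h'; exact h.2 ⟨h.1.1, h'⟩⟩
  have hTcard : (T.card : ℝ) ≤
      (Finset.range (p i0) \ A).card + ((p (istar + 1) : ℝ) - p i0) := by
    have h1 := (Finset.card_le_card hTsub).trans (Finset.card_union_le _ _)
    rw [Nat.card_Ico] at h1
    rw [← Nat.cast_sub (hp.mono_of_le (by omega) (by omega))]
    exact_mod_cast h1
  have hsecond : OPT d d s (Finset.range m \ Finset.range (istar + 1)) T ≤ T.card * d istar := by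
    refine OPT_le _ _ _ _ _ fun S hS => profit_le_card_mul _ _ _ _ _ _ hds.le ?_ ?_ hS
    · intro i hi
      exact hd i (by simp at hi; omega)
    · intro i hi
      simp only [Finset.mem_sdiff, Finset.mem_range] at hi
      exact hdm istar i (by omega) hi.1
  have htail : ((p (istar + 1) : ℝ) - p i0) * d istar ≤
      ∑ i ∈ Finset.Ico i0 (istar + 1), d i := by
    rw [← Finset.sum_Ico_sub (fun i => (p i : ℝ)) (show i0 ≤ istar + 1 by omega), Finset.sum_mul]
    refine Finset.sum_le_sum fun i hi => ?_
    rw [Finset.mem_Ico] at hi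
    have hlt := hmidne i hi.1 (by omega)
    refine card_mul_le_of_minimal_block hlt hds (hdm i istar (by omega) hsm')
      (hcov i (by omega) hlt).2 fun j _ h2 => hbigitem j ?_
    exact h2.trans_le (hp.mono_of_le (by omega) (by omega))
  suffices hfirst : OPT d d s (Finset.range (istar + 1)) A ≤
      2 * ∑ i ∈ Finset.range (istar + 1), (if p i < p (i + 1) then 1 else 0) * d i -
        T.card * d istar by linarith
  refine OPT_le _ _ _ _ _ fun S hS => ?_
  set f : ℕ → ℝ := fun i => if d i ≤ ∑ j ∈ S i, s j then 1 else 0 with hf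
  set g : ℕ → ℝ := fun i => if p i < p (i + 1) then 1 else 0 with hg
  have hf1 : ∀ i, f i ≤ 1 := fun i => by
    simp only [hf]
    split_ifs <;> norm_num
  have hprofit : profit d d s (Finset.range (istar + 1)) S =
      ∑ i ∈ Finset.range (istar + 1), f i * d i := by
    simp [profit, hf]
  have hcount : ∀ i ≤ i0, (p i : ℝ) ≤ 2 * ∑ k ∈ Finset.range i, g k := by
    intro i hi
    induction i with
    | zero => simp [hp0]
    | succ i ih =>
      have ih := ih (by omega)
      rw [Finset.sum_range_succ]
      by_cases hlt : p i < p (i + 1)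
      · have h1 : (p (i + 1) : ℝ) ≤ p i + 2 := by exact_mod_cast htwo' i (by omega)
        simp only [hg, if_pos hlt] at ih ⊢
        linarith
      · rw [(hskip i (by omega) hlt).1]
        simp only [hg, if_neg hlt] at ih ⊢
        linarith
  have hskipped : ∀ e < i0, ¬ p e < p (e + 1) →
      ∑ k ∈ Finset.range (e + 1), f k + (Finset.range (p (e + 1)) \ A).card ≤ p (e + 1) := by
    intro e he hlt
    obtain ⟨h1, h2⟩ := hskip e (by omega) hlt
    have h3 := card_covered_le_of_skipped hs (fun i hi => hdm i e hi (by omega)) hAn hS h2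
    have h4 := Finset.card_sdiff_add_card_inter (Finset.range (p e)) A
    rw [Finset.card_range, Finset.inter_comm] at h4
    have h5 : ∑ k ∈ Finset.range (e + 1), f k =
        ((Finset.range (e + 1)).filter fun i => d i ≤ ∑ j ∈ S i, s j).card := by
      simp [hf]
    rw [h1, h5]
    exact_mod_cast (by omega : _ + (Finset.range (p e) \ A).card ≤ p e)
  have hprefix : ∀ i ≤ i0, 0 ≤ ∑ k ∈ Finset.range i, (2 * g k - f k) := by
    intro i hi
    induction i with
    | zero => simp
    | succ i ih =>
      by_cases hlt : p i < p (i + 1)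
      · have ih := ih (by omega)
        have hgi : g i = 1 := if_pos hlt
        rw [Finset.sum_range_succ, hgi]
        linarith [hf1 i]
      · rw [Finset.sum_sub_distrib, ← Finset.mul_sum]
        have h1 := hskipped i (by omega) hlt
        have h2 := hcount (i + 1) hi
        have h3 : (0 : ℝ) ≤ (Finset.range (p (i + 1)) \ A).card := Nat.cast_nonneg _
        linarith
  have hmargin : ((Finset.range (p i0) \ A).card : ℝ) ≤
      ∑ k ∈ Finset.range i0, (2 * g k - f k) := by
    rcases Nat.eq_zero_or_pos i0 with h | h
    · simp [h, hp0]
    · obtain ⟨e, rfl⟩ : ∃ e, i0 = e + 1 := ⟨i0 - 1, by omega⟩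
      rw [Finset.sum_sub_distrib, ← Finset.mul_sum]
      linarith [hskipped e (by omega) (hlast e rfl), hcount (e + 1) le_rfl]
  have habel := mul_sum_le_sum_mul_of_antitone (fun k => 2 * g k - f k) d i0 (d istar)
    (fun i i' h h' => hdm i i' h (by omega)) (fun i hi => hdm i istar (by omega) hsm') hprefix
  have hblock : ∑ i ∈ Finset.Ico i0 (istar + 1), d i ≤
      ∑ i ∈ Finset.Ico i0 (istar + 1), (2 * g i - f i) * d i := by
    refine Finset.sum_le_sum fun i hi => ?_
    rw [Finset.mem_Ico] at hi
    have hgi : g i = 1 := if_pos (hmidne i hi.1 (by omega))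
    rw [hgi]
    nlinarith [hf1 i, hd i (by omega)]
  have hsplit := Finset.sum_range_add_sum_Ico (fun i => (2 * g i - f i) * d i)
    (show i0 ≤ istar + 1 by omega)
  have hexpand : ∑ i ∈ Finset.range (istar + 1), (2 * g i - f i) * d i =
      2 * ∑ i ∈ Finset.range (istar + 1), g i * d i -
        ∑ i ∈ Finset.range (istar + 1), f i * d i := by
    rw [Finset.mul_sum, ← Finset.sum_sub_distrib]
    exact Finset.sum_congr rfl fun i _ => by ring
  have hTm := mul_le_mul_of_nonneg_right hTcard hds.le
  have hmm := mul_le_mul_of_nonneg_left hmargin hds.le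
  rw [hprofit]
  linarith

end BinCov
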